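/- Fix real κ, σ, t with σ ≠ 0, t > 0, and u ∈ ℂ, and for ρ ∈ ℝ define ξ(ρ) := κ − σρiu, d(ρ) := (ξ(ρ)² + σ²(u²+iu))^{1/2} (principal square root), A₁(ρ) := (u²+iu)·sinh(d(ρ)t/2), A₂(ρ) := d(ρ)·cosh(d(ρ)t/2) + ξ(ρ)·sinh(d(ρ)t/2), and A(ρ) := A₁(ρ)/A₂(ρ). Suppose at ρ₀ the radicand ξ(ρ₀)² + σ²(u²+iu) does not lie in (−∞, 0] and A₂(ρ₀) ≠ 0. Then ρ ↦ A(ρ) is differentiable at ρ₀ with derivative ∂A/∂ρ = (1/A₂(ρ₀))·A₁' − (A(ρ₀)/A₂(ρ₀))·A₂', where A₁' := − iu(u²+iu) t ξ(ρ₀) σ cosh(d(ρ₀)t/2)/(2 d(ρ₀)) and A₂' := − σ iu (2 + tξ(ρ₀))(ξ(ρ₀) cosh(d(ρ₀)t/2) + d(ρ₀) sinh(d(ρ₀)t/2))/(2 d(ρ₀)). -/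

import Mathlib

noncomputable section

/-- Principal complex square root `z^{1/2} := exp((1/2)·Log z)`. -/
def csqrt (z : ℂ) : ℂ := Complex.exp ((1 / 2 : ℂ) * Complex.log z)

/-- `ξ(ρ) := κ − σρiu`. -/
def ξf (κ σ : ℝ) (u : ℂ) (ρ : ℝ) : ℂ := (κ : ℂ) - (σ : ℂ) * (ρ : ℂ) * Complex.I * u

/-- `d(ρ) := (ξ(ρ)² + σ²(u²+iu))^{1/2}` (principal square root). -/
def df (κ σ : ℝ) (u : ℂ) (ρ : ℝ) : ℂ :=
  csqrt ((ξf κ σ u ρ) ^ 2 + (σ : ℂ) ^ 2 * (u ^ 2 + Complex.I * u))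

/-- `A₁(ρ) := (u²+iu)·sinh(d(ρ)t/2)`. -/
def A₁f (κ σ t : ℝ) (u : ℂ) (ρ : ℝ) : ℂ :=
  (u ^ 2 + Complex.I * u) * Complex.sinh (df κ σ u ρ * (t : ℂ) / 2)

/-- `A₂(ρ) := d(ρ)·cosh(d(ρ)t/2) + ξ(ρ)·sinh(d(ρ)t/2)`. -/
def A₂f (κ σ t : ℝ) (u : ℂ) (ρ : ℝ) : ℂ :=
  df κ σ u ρ * Complex.cosh (df κ σ u ρ * (t : ℂ) / 2) +
    ξf κ σ u ρ * Complex.sinh (df κ σ u ρ * (t : ℂ) / 2)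

/-- `A(ρ) := A₁(ρ)/A₂(ρ)`. -/
def Af (κ σ t : ℝ) (u : ℂ) (ρ : ℝ) : ℂ := A₁f κ σ t u ρ / A₂f κ σ t u ρ

theorem csqrt_ne_zero (z : ℂ) : csqrt z ≠ 0 := Complex.exp_ne_zero _

theorem csqrt_mul_self {z : ℂ} (hz : z ≠ 0) : csqrt z * csqrt z = z := by
  rw [csqrt, ← Complex.exp_add, ← add_mul, add_halves, one_mul, Complex.exp_log hz]

theorem hasDerivAt_csqrt {z : ℂ} (hz : z ∈ Complex.slitPlane) :
    HasDerivAt csqrt (1 / (2 * csqrt z)) z := by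
  have h : HasDerivAt csqrt (csqrt z * ((1 / 2 : ℂ) * z⁻¹)) z :=
    ((Complex.hasDerivAt_log hz).const_mul (1 / 2 : ℂ)).cexp
  refine h.congr_deriv ?_
  have hz0 : z ≠ 0 := Complex.slitPlane_ne_zero hz
  have hs : csqrt z ≠ 0 := csqrt_ne_zero z
  field_simp
  rw [pow_two, csqrt_mul_self hz0]

theorem hasDerivAt_ξf (κ σ : ℝ) (u : ℂ) (ρ : ℝ) :
    HasDerivAt (ξf κ σ u) (-((σ : ℂ) * Complex.I * u)) ρ := by
  have h : HasDerivAt (ξf κ σ u) (-((σ : ℂ) * 1 * Complex.I * u)) ρ :=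
    ((((hasDerivAt_id ρ).ofReal_comp.const_mul (σ : ℂ)).mul_const Complex.I).mul_const
      u).const_sub (κ : ℂ)
  rwa [mul_one] at h

theorem hasDerivAt_df {κ σ : ℝ} {u : ℂ} {ρ : ℝ}
    (hw : (ξf κ σ u ρ) ^ 2 + (σ : ℂ) ^ 2 * (u ^ 2 + Complex.I * u) ∈ Complex.slitPlane) :
    HasDerivAt (df κ σ u) (-((σ : ℂ) * Complex.I * u * ξf κ σ u ρ) / df κ σ u ρ) ρ := by
  have h := (hasDerivAt_csqrt hw).comp ρ
    (((hasDerivAt_ξf κ σ u ρ).pow 2).add_const ((σ : ℂ) ^ 2 * (u ^ 2 + Complex.I * u)))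
  refine HasDerivAt.congr_deriv (f := df κ σ u) h ?_
  have hd : df κ σ u ρ ≠ 0 := csqrt_ne_zero _
  change 1 / (2 * df κ σ u ρ) * _ = _
  field_simp
  push_cast
  ring

/-- `∂A/∂ρ = (1/A₂)·A₁' − (A/A₂)·A₂'` with the explicit expressions for
`A₁' = ∂A₁/∂ρ` and `A₂' = ∂A₂/∂ρ`. -/
theorem hasDerivAt_A_rho (κ σ t : ℝ) (hσ : σ ≠ 0) (ht : 0 < t) (u : ℂ) (ρ₀ : ℝ)
    (hw : (ξf κ σ u ρ₀) ^ 2 + (σ : ℂ) ^ 2 * (u ^ 2 + Complex.I * u) ∈ Complex.slitPlane)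
    (hA₂0 : A₂f κ σ t u ρ₀ ≠ 0) (A₁' A₂' : ℂ)
    (hA₁' : A₁' = -(Complex.I * u * (u ^ 2 + Complex.I * u) * (t : ℂ) * ξf κ σ u ρ₀ * (σ : ℂ)) *
      Complex.cosh (df κ σ u ρ₀ * (t : ℂ) / 2) / (2 * df κ σ u ρ₀))
    (hA₂' : A₂' = -((σ : ℂ) * Complex.I * u * (2 + (t : ℂ) * ξf κ σ u ρ₀)) *
      (ξf κ σ u ρ₀ * Complex.cosh (df κ σ u ρ₀ * (t : ℂ) / 2) +
        df κ σ u ρ₀ * Complex.sinh (df κ σ u ρ₀ * (t : ℂ) / 2)) / (2 * df κ σ u ρ₀)) :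
    HasDerivAt (Af κ σ t u)
      ((1 / A₂f κ σ t u ρ₀) * A₁' - (Af κ σ t u ρ₀ / A₂f κ σ t u ρ₀) * A₂') ρ₀ := by
  have hd : df κ σ u ρ₀ ≠ 0 := csqrt_ne_zero _
  have hdd := hasDerivAt_df hw
  have hθ := (hdd.mul_const (t : ℂ)).div_const 2
  have hsinh := (Complex.hasDerivAt_sinh _).comp ρ₀ hθ
  have hcosh := (Complex.hasDerivAt_cosh _).comp ρ₀ hθ
  have h₁ : HasDerivAt (A₁f κ σ t u) A₁' ρ₀ := by
    refine HasDerivAt.congr_deriv (hsinh.const_mul (u ^ 2 + Complex.I * u)) ?_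
    rw [hA₁']
    field_simp
  have h₂ : HasDerivAt (A₂f κ σ t u) A₂' ρ₀ := by
    refine HasDerivAt.congr_deriv
      ((hdd.mul hcosh).add ((hasDerivAt_ξf κ σ u ρ₀).mul hsinh)) ?_
    rw [hA₂', Function.comp_apply]
    field_simp
    ring
  refine (h₁.div h₂ hA₂0).congr_deriv ?_
  rw [Af]
  field_simp
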